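/- The Hilbert system obtained by adding to the base logic all instances of the schema (C_G) (□_Gφ ∧ □_Hψ) → □_{G∪H}(φ∧ψ) for all finite nonempty G, H ⊆ I (no disjointness requirement) is sound and strongly complete with respect to the class of all models in which each N_i(w) is closed under finite intersections: if X, Y ∈ N_i(w) then X ∩ Y ∈ N_i(w). -/

import Mathlib

attribute [local instance] Classical.propDecidable

/-- Formulas of the multi-modal language 𝔏: atoms, ⊥, ¬, ∨, and □_G for
finite nonempty G ⊆ I. -/
inductive Form (I : Type) : Type
  | atom : ℕ → Form I
  | bot  : Form I
  | neg  : Form I → Form I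
  | or   : Form I → Form I → Form I
  | box  : (G : Finset I) → G.Nonempty → Form I → Form I

namespace Form
variable {I : Type}
/-- φ ∧ ψ -/
def and (φ ψ : Form I) : Form I := .neg (.or (.neg φ) (.neg ψ))
/-- φ → ψ -/
def imp (φ ψ : Form I) : Form I := .or (.neg φ) ψ
/-- ⊤ -/
def top : Form I := .neg .bot
/-- φ ↔ ψ -/
def iff (φ ψ : Form I) : Form I := (φ.imp ψ).and (ψ.imp φ)
end Form

/-- The pointwise-intersection neighbourhood function:
`N_G(w) = { ⋂_{i∈G} X_i : X_i ∈ N_i(w) }`. -/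
def ptwInter {I W : Type} (N : I → W → Set (Set W)) (G : Finset I) (w : W) :
    Set (Set W) :=
  { X | ∃ Y : I → Set W, (∀ i ∈ G, Y i ∈ N i w) ∧ X = ⋂ i ∈ G, Y i }

/-- Satisfaction at a world, relative to neighbourhood functions `N` and a
valuation `V`. -/
def satN {I W : Type} (N : I → W → Set (Set W)) (V : ℕ → Set W) :
    Form I → W → Prop
  | .atom n, w => w ∈ V n
  | .bot, _ => False
  | .neg φ, w => ¬ satN N V φ w
  | .or φ ψ, w => satN N V φ w ∨ satN N V ψ w
  | .box G _ φ, w => { v | satN N V φ v } ∈ ptwInter N G w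

/-- A neighbourhood model. -/
structure NbhModel (I : Type) where
  W : Type
  ne : Nonempty W
  N : I → W → Set (Set W)
  V : ℕ → Set W

/-- Truth in a model. -/
def NbhModel.sat {I : Type} (M : NbhModel I) (w : M.W) (φ : Form I) : Prop :=
  satN M.N M.V φ w

/-- Propositional evaluation treating atoms and boxed formulas as atomic. -/
def evalP {I : Type} (v : Form I → Prop) : Form I → Prop
  | .atom n => v (.atom n)
  | .bot => False
  | .neg φ => ¬ evalP v φ
  | .or φ ψ => evalP v φ ∨ evalP v ψ
  | .box G h φ => v (.box G h φ)

/-- Classical propositional tautologies (in the extended modal language). -/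
def Tautology {I : Type} (φ : Form I) : Prop := ∀ v, evalP v φ

theorem unionNE {I : Type} [DecidableEq I] {G H : Finset I}
    (hG : G.Nonempty) : (G ∪ H).Nonempty :=
  hG.mono Finset.subset_union_left

/-- Axiom schema B1: `(□_Gφ ∧ □_Hψ) → □_{G∪H}(φ∧ψ)` for disjoint G, H. -/
def B1Ax (I : Type) [DecidableEq I] : Set (Form I) :=
  { χ | ∃ (G H : Finset I) (hG : G.Nonempty) (hH : H.Nonempty) (φ ψ : Form I),
      Disjoint G H ∧
      χ = ((Form.box G hG φ).and (Form.box H hH ψ)).imp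
            (Form.box (G ∪ H) (unionNE hG) (φ.and ψ)) }

/-- Axiom schema B2: `□_{G∪H}⊤ → □_G⊤`. -/
def B2Ax (I : Type) [DecidableEq I] : Set (Form I) :=
  { χ | ∃ (G H : Finset I) (hG : G.Nonempty) (_hH : H.Nonempty),
      χ = (Form.box (G ∪ H) (unionNE hG) Form.top).imp (Form.box G hG Form.top) }

/-- Axiom schema B3: `(□_Gφ ∧ □_{G∪H∪J}φ) → □_{G∪H}φ`. -/
def B3Ax (I : Type) [DecidableEq I] : Set (Form I) :=
  { χ | ∃ (G H J : Finset I) (hG : G.Nonempty) (_hH : H.Nonempty)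
      (_hJ : J.Nonempty) (φ : Form I),
      χ = ((Form.box G hG φ).and (Form.box (G ∪ H ∪ J) (unionNE (unionNE hG)) φ)).imp
            (Form.box (G ∪ H) (unionNE hG) φ) }

/-- Axiom schema B4: `(□_Gφ ∧ □_H(φ∨ψ)) → □_{G∪H}φ`. -/
def B4Ax (I : Type) [DecidableEq I] : Set (Form I) :=
  { χ | ∃ (G H : Finset I) (hG : G.Nonempty) (hH : H.Nonempty) (φ ψ : Form I),
      χ = ((Form.box G hG φ).and (Form.box H hH (φ.or ψ))).imp
            (Form.box (G ∪ H) (unionNE hG) φ) }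

/-- The axioms of the base logic. -/
def BaseAx (I : Type) [DecidableEq I] : Set (Form I) :=
  B1Ax I ∪ B2Ax I ∪ B3Ax I ∪ B4Ax I

/-- Hilbert-style provability from classical tautologies and the axioms in
`Ax`, closed under modus ponens and replacement of equivalents. -/
inductive Prv {I : Type} (Ax : Set (Form I)) : Form I → Prop
  | taut {φ : Form I} : Tautology φ → Prv Ax φ
  | ax {φ : Form I} : φ ∈ Ax → Prv Ax φ
  | mp {φ ψ : Form I} : Prv Ax (φ.imp ψ) → Prv Ax φ → Prv Ax ψ
  | re {φ ψ : Form I} (G : Finset I) (hG : G.Nonempty) :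
      Prv Ax (φ.iff ψ) → Prv Ax ((Form.box G hG φ).iff (Form.box G hG ψ))

/-- `Γ ⊢ φ` iff there are `ψ₁,…,ψₙ ∈ Γ` with `⊢ (ψ₁∧…∧ψₙ) → φ`. -/
def Deduces {I : Type} (Ax : Set (Form I)) (Γ : Set (Form I)) (φ : Form I) :
    Prop :=
  ∃ l : List (Form I), (∀ ψ ∈ l, ψ ∈ Γ) ∧
    Prv Ax ((l.foldr Form.and Form.top).imp φ)

/-- Semantic consequence over a class of models. -/
def SemConseq {I : Type} (C : NbhModel I → Prop) (Γ : Set (Form I))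
    (φ : Form I) : Prop :=
  ∀ M : NbhModel I, C M → ∀ w : M.W, (∀ ψ ∈ Γ, M.sat w ψ) → M.sat w φ

/-- Soundness and strong completeness of `Ax` w.r.t. the class `C`. -/
def SoundComplete {I : Type} (Ax : Set (Form I)) (C : NbhModel I → Prop) :
    Prop :=
  ∀ (Γ : Set (Form I)) (φ : Form I), Deduces Ax Γ φ ↔ SemConseq C Γ φ

/-- The unrestricted schema (C_G): (□_Gφ ∧ □_Hψ) → □_{G∪H}(φ∧ψ) for all
finite nonempty G, H ⊆ I (no disjointness requirement). -/
def CGAx (I : Type) [DecidableEq I] : Set (Form I) :=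
  { χ | ∃ (G H : Finset I) (hG : G.Nonempty) (hH : H.Nonempty) (φ ψ : Form I),
      χ = ((Form.box G hG φ).and (Form.box H hH ψ)).imp
            (Form.box (G ∪ H) (unionNE hG) (φ.and ψ)) }

section Semantics

variable {I W : Type} {N : I → W → Set (Set W)} {V : ℕ → Set W}

theorem satN_and {φ ψ : Form I} {w : W} :
    satN N V (φ.and ψ) w ↔ satN N V φ w ∧ satN N V ψ w := by
  simp [Form.and, satN]

theorem satN_imp {φ ψ : Form I} {w : W} :
    satN N V (φ.imp ψ) w ↔ (satN N V φ w → satN N V ψ w) := by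
  simp only [Form.imp, satN]
  tauto

theorem satN_iff {φ ψ : Form I} {w : W} :
    satN N V (φ.iff ψ) w ↔ (satN N V φ w ↔ satN N V ψ w) := by
  simp only [Form.iff, satN_and, satN_imp]
  tauto

theorem evalP_satN (φ : Form I) (w : W) :
    evalP (fun ψ => satN N V ψ w) φ ↔ satN N V φ w := by
  induction φ with
  | atom n => rfl
  | bot => rfl
  | neg φ ih => simp only [evalP, satN, ih]
  | or φ ψ ih₁ ih₂ => simp only [evalP, satN, ih₁, ih₂]
  | box G h φ _ => rfl

theorem satN_foldr_and {l : List (Form I)} {w : W} :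
    satN N V (l.foldr Form.and Form.top) w ↔ ∀ ψ ∈ l, satN N V ψ w := by
  induction l with
  | nil => simp [Form.top, satN]
  | cons a l ih => simp [satN_and, ih]

variable [DecidableEq I] {G H J : Finset I} {w : W} {A B : Set W}

theorem inter_mem_ptwInter_union
    (hN : ∀ (i : I) (w : W) (X Y : Set W), X ∈ N i w → Y ∈ N i w → X ∩ Y ∈ N i w)
    (hA : A ∈ ptwInter N G w) (hB : B ∈ ptwInter N H w) :
    A ∩ B ∈ ptwInter N (G ∪ H) w := by
  obtain ⟨Y, hY, rfl⟩ := hA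
  obtain ⟨Z, hZ, rfl⟩ := hB
  refine ⟨fun i => if i ∈ G then (if i ∈ H then Y i ∩ Z i else Y i) else Z i, ?_, ?_⟩
  · intro i hi
    by_cases hG : i ∈ G <;> by_cases hH : i ∈ H <;> simp only [hG, hH, if_true, if_false]
    · exact hN _ _ _ _ (hY i hG) (hZ i hH)
    · exact hY i hG
    · exact hZ i hH
    · simp [hG, hH] at hi
  · ext x
    simp only [Set.mem_inter_iff, Set.mem_iInter, Finset.mem_union]
    constructor
    · rintro ⟨h₁, h₂⟩ i hi
      by_cases hG : i ∈ G <;> by_cases hH : i ∈ H <;> simp_all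
    · intro h
      refine ⟨fun i hi => ?_, fun i hi => ?_⟩
      · have := h i (Or.inl hi)
        by_cases hH : i ∈ H <;> simp_all
      · have := h i (Or.inr hi)
        by_cases hG : i ∈ G <;> simp_all

theorem mem_ptwInter_union_of_subset (hA : A ∈ ptwInter N G w)
    (hB : B ∈ ptwInter N H w) (hAB : A ⊆ B) : A ∈ ptwInter N (G ∪ H) w := by
  obtain ⟨Y, hY, rfl⟩ := hA
  obtain ⟨Z, hZ, rfl⟩ := hB
  refine ⟨fun i => if i ∈ G then Y i else Z i, ?_, ?_⟩
  · intro i hi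
    by_cases hG : i ∈ G
    · simpa [hG] using hY i hG
    · simpa [hG] using hZ i (by simpa [hG] using hi)
  · ext x
    constructor
    · intro hx
      have hx' := hAB hx
      simp only [Set.mem_iInter, Finset.mem_union] at hx hx' ⊢
      intro i hi
      by_cases hG : i ∈ G <;> simp_all
    · intro hx
      simp only [Set.mem_iInter, Finset.mem_union] at hx ⊢
      intro i hi
      simpa [hi] using hx i (Or.inl hi)

theorem mem_ptwInter_union_of_mem_union (hA : A ∈ ptwInter N G w)
    (hA' : A ∈ ptwInter N (G ∪ H ∪ J) w) : A ∈ ptwInter N (G ∪ H) w := by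
  obtain ⟨Z, hZ, hAZ⟩ := hA'
  refine (mem_ptwInter_union_of_subset hA
    ⟨Z, fun i hi => hZ i (by simp [hi]), rfl⟩ ?_ : A ∈ ptwInter N (G ∪ H) w)
  rw [hAZ]
  intro x hx
  simp only [Set.mem_iInter] at hx ⊢
  exact fun i hi => hx i (by simp [hi])

theorem univ_mem_ptwInter_of_union (h : Set.univ ∈ ptwInter N (G ∪ H) w) :
    Set.univ ∈ ptwInter N G w := by
  obtain ⟨Y, hY, hU⟩ := h
  refine ⟨Y, fun i hi => hY i (by simp [hi]), ?_⟩
  symm at hU ⊢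
  simp only [Set.iInter_eq_univ] at hU ⊢
  exact fun i hi => hU i (by simp [hi])

theorem Prv.sound {φ : Form I} (hφ : Prv (BaseAx I ∪ CGAx I) φ)
    (hN : ∀ (i : I) (w : W) (X Y : Set W), X ∈ N i w → Y ∈ N i w → X ∩ Y ∈ N i w)
    (w : W) : satN N V φ w := by
  induction hφ generalizing w with
  | taut h => exact (evalP_satN _ w).1 (h _)
  | mp _ _ ih₁ ih₂ => exact satN_imp.1 (ih₁ w) (ih₂ w)
  | re G hG _ ih =>
    rw [satN_iff]
    simp only [satN, satN_iff.1 (ih _)]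
  | ax h =>
    have hC : ∀ (G H : Finset I) (hG : G.Nonempty) (hH : H.Nonempty) (φ ψ : Form I),
        satN N V (((Form.box G hG φ).and (Form.box H hH ψ)).imp
            (Form.box (G ∪ H) (unionNE hG) (φ.and ψ))) w := by
      intro G H hG hH φ ψ
      rw [satN_imp, satN_and]
      rintro ⟨h₁, h₂⟩
      simp only [satN, satN_and]
      exact inter_mem_ptwInter_union hN h₁ h₂
    rcases h with (((h | h) | h) | h) | h
    · obtain ⟨G, H, hG, hH, φ, ψ, -, rfl⟩ := h
      exact hC G H hG hH φ ψ
    · obtain ⟨G, H, hG, hH, rfl⟩ := h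
      rw [satN_imp]
      intro h
      have hT : {v | satN N V Form.top v} = Set.univ := by
        ext; simp [Form.top, satN]
      simp only [satN, hT] at h ⊢
      exact univ_mem_ptwInter_of_union h
    · obtain ⟨G, H, J, hG, hH, hJ, φ, rfl⟩ := h
      rw [satN_imp, satN_and]
      rintro ⟨h₁, h₂⟩
      exact mem_ptwInter_union_of_mem_union h₁ h₂
    · obtain ⟨G, H, hG, hH, φ, ψ, rfl⟩ := h
      rw [satN_imp, satN_and]
      rintro ⟨h₁, h₂⟩
      exact mem_ptwInter_union_of_subset h₁ h₂ fun x hx => Or.inl hx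
    · obtain ⟨G, H, hG, hH, φ, ψ, rfl⟩ := h
      exact hC G H hG hH φ ψ

end Semantics

section Deduction

variable {I : Type} {Ax : Set (Form I)} {Γ Δ : Set (Form I)} {φ ψ χ : Form I}

theorem evalP_and {v : Form I → Prop} :
    evalP v (φ.and ψ) ↔ evalP v φ ∧ evalP v ψ := by
  simp [Form.and, evalP]

theorem evalP_imp {v : Form I → Prop} :
    evalP v (φ.imp ψ) ↔ (evalP v φ → evalP v ψ) := by
  simp only [Form.imp, evalP]
  tauto

theorem evalP_foldr_and {v : Form I → Prop} {l : List (Form I)} :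
    evalP v (l.foldr Form.and Form.top) ↔ ∀ ψ ∈ l, evalP v ψ := by
  induction l with
  | nil => simp [Form.top, evalP]
  | cons a l ih => simp [evalP_and, ih]

theorem Deduces.mono (h : Γ ⊆ Δ) (hφ : Deduces Ax Γ φ) : Deduces Ax Δ φ :=
  let ⟨l, hl, hp⟩ := hφ
  ⟨l, fun ψ hψ => h (hl ψ hψ), hp⟩

theorem Deduces.of_prv (h : Prv Ax φ) : Deduces Ax Γ φ :=
  ⟨[], by simp, .mp (.taut fun v => by simp only [evalP_imp]; tauto) h⟩

theorem Deduces.of_mem (h : φ ∈ Γ) : Deduces Ax Γ φ :=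
  ⟨[φ], by simpa using h, .taut fun v => by
    rw [evalP_imp, evalP_foldr_and]; intro h; exact h φ (by simp)⟩

theorem Deduces.mp (h₁ : Deduces Ax Γ (φ.imp ψ)) (h₂ : Deduces Ax Γ φ) :
    Deduces Ax Γ ψ := by
  obtain ⟨l₁, hl₁, hp₁⟩ := h₁
  obtain ⟨l₂, hl₂, hp₂⟩ := h₂
  refine ⟨l₁ ++ l₂, fun χ hχ => (List.mem_append.1 hχ).elim (hl₁ χ) (hl₂ χ), ?_⟩
  refine .mp (.mp (.taut fun v => ?_) hp₁) hp₂
  simp only [evalP_imp, evalP_foldr_and, List.mem_append]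
  intro h₁ h₂ h
  exact h₁ (fun χ hχ => h χ (Or.inl hχ)) (h₂ fun χ hχ => h χ (Or.inr hχ))

theorem Deduces.imp_of_insert (h : Deduces Ax (insert φ Γ) ψ) :
    Deduces Ax Γ (φ.imp ψ) := by
  obtain ⟨l, hl, hp⟩ := h
  refine ⟨l.filter (· ≠ φ), fun χ hχ => ?_, .mp (.taut fun v => ?_) hp⟩
  · simp only [List.mem_filter, decide_eq_true_eq] at hχ
    exact (hl χ hχ.1).resolve_left hχ.2
  · simp only [evalP_imp, evalP_foldr_and, List.mem_filter, decide_eq_true_eq]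
    intro h₁ h₂ h₃
    refine h₁ fun χ hχ => ?_
    by_cases e : χ = φ
    · exact e ▸ h₃
    · exact h₂ χ ⟨hχ, e⟩

/-- Maximal consistent sets of formulas. -/
structure IsMCS (Ax : Set (Form I)) (Δ : Set (Form I)) : Prop where
  consistent : ¬ Deduces Ax Δ .bot
  mem_or_neg_mem : ∀ φ, φ ∈ Δ ∨ φ.neg ∈ Δ

theorem exists_isMCS_of_not_deduces (h : ¬ Deduces Ax Γ φ) :
    ∃ Δ, IsMCS Ax Δ ∧ Γ ⊆ Δ ∧ φ ∉ Δ := by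
  obtain ⟨Δ, hΓ, hΔ⟩ := zorn_subset_nonempty {Δ | ¬ Deduces Ax Δ φ} (by
    intro c hc hchain hne
    refine ⟨⋃₀ c, ?_, fun s hs => Set.subset_sUnion_of_mem hs⟩
    rintro ⟨l, hl, hp⟩
    have hfin : ∀ l : List (Form I), (∀ ψ ∈ l, ψ ∈ ⋃₀ c) → ∃ s ∈ c, ∀ ψ ∈ l, ψ ∈ s := by
      intro l
      induction l with
      | nil => exact fun _ => hne.imp fun s hs => ⟨hs, by simp⟩
      | cons a l ih =>
        intro hl
        obtain ⟨s, hs, hls⟩ := ih fun ψ hψ => hl ψ (List.mem_cons_of_mem _ hψ)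
        obtain ⟨t, ht, hat⟩ := hl a List.mem_cons_self
        obtain ⟨u, hu, hsu, htu⟩ := hchain.directedOn s hs t ht
        refine ⟨u, hu, fun ψ hψ => ?_⟩
        rcases List.mem_cons.1 hψ with rfl | hψ
        · exact htu hat
        · exact hsu (hls ψ hψ)
    obtain ⟨s, hs, hls⟩ := hfin l hl
    exact hc hs ⟨l, hls, hp⟩) Γ h
  have hΔφ : ¬ Deduces Ax Δ φ := hΔ.prop
  have hins : ∀ ψ, ψ ∉ Δ → Deduces Ax Δ (ψ.imp φ) := by
    intro ψ hψ
    by_contra hn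
    refine hψ (hΔ.le_of_ge (y := insert ψ Δ) (fun h' => hn h'.imp_of_insert)
      (Set.subset_insert _ _) (Set.mem_insert _ _))
  refine ⟨Δ, ⟨fun hb => hΔφ (Deduces.mp (.of_prv (.taut fun v => ?_)) hb), fun ψ => ?_⟩,
    hΓ, fun hm => hΔφ (.of_mem hm)⟩
  · simp [evalP_imp, evalP]
  · by_contra! hn
    refine hΔφ (Deduces.mp (Deduces.mp (.of_prv (.taut fun v => ?_))
      (hins _ hn.1)) (hins _ hn.2))
    simp only [evalP_imp, evalP]
    tauto

namespace IsMCS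

theorem mem_of_deduces (hΔ : IsMCS Ax Δ) (h : Deduces Ax Δ φ) : φ ∈ Δ := by
  refine (hΔ.mem_or_neg_mem φ).resolve_right fun hn => hΔ.consistent ?_
  refine Deduces.mp (Deduces.mp (.of_prv (.taut fun v => ?_)) h) (.of_mem hn)
  simp only [evalP_imp, evalP]
  tauto

theorem mem_of_prv (hΔ : IsMCS Ax Δ) (h : Prv Ax φ) : φ ∈ Δ :=
  hΔ.mem_of_deduces (.of_prv h)

theorem mem_mp (hΔ : IsMCS Ax Δ) (h₁ : φ.imp ψ ∈ Δ) (h₂ : φ ∈ Δ) : ψ ∈ Δ :=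
  hΔ.mem_of_deduces (Deduces.mp (.of_mem h₁) (.of_mem h₂))

theorem neg_mem_iff (hΔ : IsMCS Ax Δ) : φ.neg ∈ Δ ↔ φ ∉ Δ := by
  refine ⟨fun hn h => hΔ.consistent ?_, (hΔ.mem_or_neg_mem φ).resolve_left⟩
  refine Deduces.mp (Deduces.mp (.of_prv (.taut fun v => ?_)) (.of_mem h)) (.of_mem hn)
  simp only [evalP_imp, evalP]
  tauto

theorem bot_notMem (hΔ : IsMCS Ax Δ) : Form.bot ∉ Δ :=
  fun h => hΔ.consistent (.of_mem h)

theorem top_mem (hΔ : IsMCS Ax Δ) : Form.top ∈ Δ :=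
  hΔ.neg_mem_iff.2 hΔ.bot_notMem

theorem or_mem_iff (hΔ : IsMCS Ax Δ) : φ.or ψ ∈ Δ ↔ φ ∈ Δ ∨ ψ ∈ Δ := by
  constructor
  · intro h
    by_contra! hn
    refine hn.2 (hΔ.mem_mp (hΔ.mem_mp (hΔ.mem_of_prv (.taut fun v => ?_)) h)
      (hΔ.neg_mem_iff.2 hn.1))
    simp only [evalP_imp, evalP]
    tauto
  · rintro (h | h) <;> refine hΔ.mem_mp (hΔ.mem_of_prv (.taut fun v => ?_)) h <;>
      simp only [evalP_imp, evalP] <;> tauto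

theorem and_mem_iff (hΔ : IsMCS Ax Δ) : φ.and ψ ∈ Δ ↔ φ ∈ Δ ∧ ψ ∈ Δ := by
  simp only [Form.and, hΔ.neg_mem_iff, hΔ.or_mem_iff]
  tauto

end IsMCS

theorem prv_of_forall_mem (h : ∀ Δ, IsMCS Ax Δ → φ ∈ Δ) : Prv Ax φ := by
  by_contra hn
  obtain ⟨Δ, hΔ, -, hφ⟩ := exists_isMCS_of_not_deduces (Ax := Ax) (Γ := ∅) (φ := φ) (by
    rintro ⟨l, hl, hp⟩
    obtain rfl : l = [] := List.eq_nil_iff_forall_not_mem.2 fun a ha => hl a ha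
    exact hn (.mp hp (.taut fun v => by simp [Form.top, evalP])))
  exact hφ (h Δ hΔ)

end Deduction

section Canonical

variable {I : Type} [DecidableEq I]

/-- The maximal consistent sets of the logic with unrestricted (C_G). -/
abbrev MCS (I : Type) [DecidableEq I] : Type :=
  {Δ : Set (Form I) // IsMCS (BaseAx I ∪ CGAx I) Δ}

/-- `w` contains the formula `□_G φ`. -/
def MCS.HasBox (w : MCS I) (G : Finset I) (φ : Form I) : Prop :=
  ∃ hG : G.Nonempty, Form.box G hG φ ∈ w.1

namespace MCS.HasBox

variable {w : MCS I} {G H K : Finset I} {φ ψ : Form I}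

theorem congr (h : w.HasBox G φ) (hφψ : ∀ v : MCS I, φ ∈ v.1 ↔ ψ ∈ v.1) :
    w.HasBox G ψ := by
  obtain ⟨hG, h⟩ := h
  have key : Prv (BaseAx I ∪ CGAx I) (φ.iff ψ) := by
    refine prv_of_forall_mem fun Δ hΔ => ?_
    have := hφψ ⟨Δ, hΔ⟩
    simp only [Form.iff, Form.imp, hΔ.and_mem_iff, hΔ.or_mem_iff, hΔ.neg_mem_iff]
    tauto
  have := w.2.mem_of_prv (.re G hG key)
  exact ⟨hG, w.2.mem_mp (w.2.and_mem_iff.1 this).1 h⟩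

theorem and (h₁ : w.HasBox G φ) (h₂ : w.HasBox H ψ) :
    w.HasBox (G ∪ H) (φ.and ψ) := by
  obtain ⟨hG, h₁⟩ := h₁
  obtain ⟨hH, h₂⟩ := h₂
  exact ⟨_, w.2.mem_mp (w.2.mem_of_prv (.ax (Or.inr ⟨G, H, hG, hH, φ, ψ, rfl⟩)))
    (w.2.and_mem_iff.2 ⟨h₁, h₂⟩)⟩

theorem union (h₁ : w.HasBox G φ) (h₂ : w.HasBox H ψ)
    (hφψ : ∀ v : MCS I, φ ∈ v.1 → ψ ∈ v.1) : w.HasBox (G ∪ H) φ := by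
  have h₃ : w.HasBox H (φ.or ψ) := h₂.congr fun v => by
    have := hφψ v
    rw [v.2.or_mem_iff]
    tauto
  obtain ⟨hG, h₁⟩ := h₁
  obtain ⟨hH, h₃⟩ := h₃
  exact ⟨_, w.2.mem_mp (w.2.mem_of_prv (.ax (Or.inl (Or.inr ⟨G, H, hG, hH, φ, ψ, rfl⟩))))
    (w.2.and_mem_iff.2 ⟨h₁, h₃⟩)⟩

theorem between (h₁ : w.HasBox G φ) (h₂ : w.HasBox K φ) (hGH : G ⊆ H) (hHK : H ⊆ K) :
    w.HasBox H φ := by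
  obtain ⟨hG, h₁⟩ := h₁
  obtain ⟨hK, h₂⟩ := h₂
  have e₁ : G ∪ H = H := Finset.union_eq_right.2 hGH
  have e₂ : G ∪ H ∪ K = K := by rw [e₁]; exact Finset.union_eq_right.2 hHK
  have h₂' : Form.box (G ∪ H ∪ K) (unionNE (unionNE hG)) φ ∈ w.1 := by simpa only [e₂] using h₂
  have h₃ : w.HasBox (G ∪ H) φ := ⟨_, w.2.mem_mp
    (w.2.mem_of_prv (.ax (Or.inl (Or.inl (Or.inr ⟨G, H, K, hG, hG.mono hGH, hK, φ, rfl⟩)))))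
    (w.2.and_mem_iff.2 ⟨h₁, h₂'⟩)⟩
  rwa [e₁] at h₃

theorem top_of_subset (h : w.HasBox K Form.top) (hG : G.Nonempty) (hGK : G ⊆ K) :
    w.HasBox G Form.top := by
  obtain ⟨hK, h⟩ := h
  have e : G ∪ K = K := Finset.union_eq_right.2 hGK
  have h' : Form.box (G ∪ K) (unionNE hG) Form.top ∈ w.1 := by simpa only [e] using h
  exact ⟨hG, w.2.mem_mp
    (w.2.mem_of_prv (.ax (Or.inl (Or.inl (Or.inl (Or.inr ⟨G, K, hG, hK, rfl⟩)))))) h'⟩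

theorem top_of_singletons (hG : G.Nonempty) (h : ∀ i ∈ G, w.HasBox {i} Form.top) :
    w.HasBox G Form.top := by
  induction hG using Finset.Nonempty.cons_induction with
  | singleton i => exact h i (by simp)
  | cons i s his hs ih =>
    have h₁ := (h i (by simp)).union (ih fun j hj => h j (by simp [hj])) fun _ => id
    rwa [← Finset.insert_eq, ← Finset.cons_eq_insert _ _ his] at h₁

end MCS.HasBox

/-- Pairs of a nonempty finite index set and a formula. -/
abbrev BoxLabel (I : Type) : Type := {G : Finset I // G.Nonempty} × Form I

/-- A conjunction of boxed formulas is boxed by the union of the index sets. -/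
theorem MCS.exists_hasBox_biUnion {w : MCS I} {F : Finset (BoxLabel I)} (hF : F.Nonempty)
    (h : ∀ p ∈ F, w.HasBox p.1.1 p.2) :
    ∃ χ, (∀ v : MCS I, χ ∈ v.1 ↔ ∀ p ∈ F, p.2 ∈ v.1) ∧
      w.HasBox (F.biUnion fun p => p.1.1) χ := by
  induction hF using Finset.Nonempty.cons_induction with
  | singleton p => exact ⟨p.2, by simp, by simpa using h p (by simp)⟩
  | cons p s hps hs ih =>
    obtain ⟨χ, hχ, hb⟩ := ih fun q hq => h q (by simp [hq])
    refine ⟨p.2.and χ, fun v => ?_, ?_⟩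
    · simp [v.2.and_mem_iff, hχ]
    · rw [Finset.cons_eq_insert, Finset.biUnion_insert]
      exact (h p (by simp)).and hb

theorem MCS.HasBox.union_biUnion {w : MCS I} {G : Finset I} {ψ : Form I}
    (hG : w.HasBox G ψ) {T : Finset (BoxLabel I)} (h : ∀ p ∈ T, w.HasBox p.1.1 p.2)
    (hψ : ∀ p ∈ T, ∀ v : MCS I, ψ ∈ v.1 → p.2 ∈ v.1) :
    w.HasBox (G ∪ T.biUnion fun p => p.1.1) ψ := by
  induction T using Finset.induction_on with
  | empty => simpa using hG
  | insert p s _ ih =>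
    have h₁ := ih (fun q hq => h q (by simp [hq])) fun q hq => hψ q (by simp [hq])
    have h₂ := h₁.union (h p (by simp)) (hψ p (by simp))
    rwa [Finset.biUnion_insert, Finset.union_comm p.1.1, ← Finset.union_assoc]

/-- Worlds of the canonical model: a maximal consistent set together with, for each
label `(G, φ)`, the index in `G` whose neighbourhood the copy avoids. -/
abbrev CanonicalWorld (I : Type) [DecidableEq I] : Type :=
  MCS I × ((p : BoxLabel I) → p.1.1)

/-- The intersection of the basic neighbourhoods at index `i` with labels in `S`. -/
def canonicalSet (i : I) (S : Finset (BoxLabel I)) : Set (CanonicalWorld I) :=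
  {x | ∀ p ∈ S, p.2 ∈ x.1.1 ∨ (x.2 p : I) ≠ i}

/-- The canonical neighbourhood functions. -/
def canonicalN (i : I) (w : CanonicalWorld I) : Set (Set (CanonicalWorld I)) :=
  {Z | ∃ S : Finset (BoxLabel I), S.Nonempty ∧
    (∀ p ∈ S, i ∈ p.1.1 ∧ w.1.HasBox p.1.1 p.2) ∧ Z = canonicalSet i S}

/-- The canonical valuation. -/
def canonicalV (n : ℕ) : Set (CanonicalWorld I) :=
  {x | Form.atom n ∈ x.1.1}

theorem inter_mem_canonicalN {i : I} {w : CanonicalWorld I} {X Y : Set (CanonicalWorld I)}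
    (hX : X ∈ canonicalN i w) (hY : Y ∈ canonicalN i w) : X ∩ Y ∈ canonicalN i w := by
  obtain ⟨S, hS, hSw, rfl⟩ := hX
  obtain ⟨T, hT, hTw, rfl⟩ := hY
  refine ⟨S ∪ T, hS.mono Finset.subset_union_left,
    fun p hp => (Finset.mem_union.1 hp).elim (hSw p) (hTw p), ?_⟩
  ext x
  simp only [canonicalSet, Set.mem_inter_iff, Set.mem_ofPred_eq, Finset.mem_union]
  exact ⟨fun h p hp => hp.elim (h.1 p) (h.2 p),
    fun h => ⟨fun p hp => h p (Or.inl hp), fun p hp => h p (Or.inr hp)⟩⟩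

theorem mem_ptwInter_canonicalN_of_hasBox {w : CanonicalWorld I} {H : Finset I}
    {ψ : Form I} (h : w.1.HasBox H ψ) :
    {x : CanonicalWorld I | ψ ∈ x.1.1} ∈ ptwInter canonicalN H w := by
  have hH := h.1
  refine ⟨fun i => canonicalSet i {(⟨H, hH⟩, ψ)}, fun i hi =>
    ⟨_, by simp, by simpa using ⟨hi, h⟩, rfl⟩, ?_⟩
  ext x
  simp only [canonicalSet, Finset.mem_singleton, forall_eq, Set.mem_iInter, Set.mem_ofPred_eq]
  exact ⟨fun h i _ => Or.inl h, fun h => (h _ (x.2 (⟨H, hH⟩, ψ)).2).resolve_right (by simp)⟩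

theorem hasBox_of_mem_ptwInter_canonicalN {w : CanonicalWorld I} {H : Finset I}
    (hH : H.Nonempty) {ψ : Form I}
    (h : {x : CanonicalWorld I | ψ ∈ x.1.1} ∈ ptwInter canonicalN H w) :
    w.1.HasBox H ψ := by
  obtain ⟨Y, hY, hψY⟩ := h
  choose! S hSne hSw hYS using hY
  have hmem : ∀ x : CanonicalWorld I,
      ψ ∈ x.1.1 ↔ ∀ i ∈ H, ∀ p ∈ S i, p.2 ∈ x.1.1 ∨ (x.2 p : I) ≠ i := by
    intro x
    have hx : ψ ∈ x.1.1 ↔ x ∈ ⋂ i ∈ H, Y i := by rw [← hψY]; rfl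
    rw [hx, Set.mem_iInter₂]
    exact forall₂_congr fun i hi => by rw [hYS i hi]; rfl
  set T : Finset (BoxLabel I) := H.biUnion S with hT
  set F : Finset (BoxLabel I) := T.filter fun p => ∀ i ∈ p.1.1, i ∈ H ∧ p ∈ S i with hF
  have hTw : ∀ p ∈ T, w.1.HasBox p.1.1 p.2 := by
    intro p hp
    obtain ⟨i, hi, hpi⟩ := Finset.mem_biUnion.1 hp
    exact (hSw i hi p hpi).2
  have hψT : ∀ p ∈ T, ∀ v : MCS I, ψ ∈ v.1 → p.2 ∈ v.1 := by
    intro p hp v hv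
    obtain ⟨i, hi, hpi⟩ := Finset.mem_biUnion.1 hp
    let c : (q : BoxLabel I) → q.1.1 :=
      Function.update (fun q => ⟨_, q.1.2.choose_spec⟩) p ⟨i, (hSw i hi p hpi).1⟩
    exact ((hmem (v, c)).1 hv i hi p hpi).resolve_right (by simp [c])
  have hFψ : ∀ v : MCS I, (∀ p ∈ F, p.2 ∈ v.1) → ψ ∈ v.1 := by
    intro v hv
    have hc : ∀ p : BoxLabel I, ∃ i : p.1.1,
        (¬ ∀ j ∈ p.1.1, j ∈ H ∧ p ∈ S j) → ¬ ((i : I) ∈ H ∧ p ∈ S i) := by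
      intro p
      by_cases hp : ∀ j ∈ p.1.1, j ∈ H ∧ p ∈ S j
      · exact ⟨⟨_, p.1.2.choose_spec⟩, fun h => absurd hp h⟩
      · obtain ⟨j, hj, hjn⟩ : ∃ j ∈ p.1.1, ¬ (j ∈ H ∧ p ∈ S j) := by
          simpa only [not_forall, exists_prop] using hp
        exact ⟨⟨j, hj⟩, fun _ => hjn⟩
    choose c hc using hc
    refine (hmem (v, c)).2 fun i hi p hpi => ?_
    by_cases hp : ∀ j ∈ p.1.1, j ∈ H ∧ p ∈ S j
    · exact Or.inl (hv p (Finset.mem_filter.2 ⟨Finset.mem_biUnion.2 ⟨i, hi, hpi⟩, hp⟩))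
    · exact Or.inr fun e => hc p hp (e ▸ ⟨hi, e ▸ hpi⟩)
  rcases F.eq_empty_or_nonempty with hFe | hFne
  · have hψ : ∀ v : MCS I, ψ ∈ v.1 := fun v => hFψ v (by simp [hFe])
    refine (MCS.HasBox.top_of_singletons hH fun i hi => ?_).congr
      fun v => iff_of_true v.2.top_mem (hψ v)
    obtain ⟨p, hp⟩ := hSne i hi
    have hpT : p ∈ T := Finset.mem_biUnion.2 ⟨i, hi, hp⟩
    refine ((hTw p hpT).congr fun v => iff_of_true (hψT p hpT v (hψ v)) v.2.top_mem).top_of_subset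
      (by simp) (by simpa using (hSw i hi p hp).1)
  · obtain ⟨χ, hχ, hb⟩ := MCS.exists_hasBox_biUnion hFne
      fun p hp => hTw p (Finset.mem_filter.1 hp).1
    have hbψ := hb.congr fun v => (hχ v).trans
      ⟨hFψ v, fun hv p hp => hψT p (Finset.mem_filter.1 hp).1 v hv⟩
    refine hbψ.between (hbψ.union_biUnion hTw hψT) (fun i hi => ?_) fun i hi => ?_
    · obtain ⟨p, hp, hip⟩ := Finset.mem_biUnion.1 hi
      exact ((Finset.mem_filter.1 hp).2 i hip).1
    · obtain ⟨p, hp⟩ := hSne i hi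
      exact Finset.mem_union_right _ (Finset.mem_biUnion.2
        ⟨p, Finset.mem_biUnion.2 ⟨i, hi, hp⟩, (hSw i hi p hp).1⟩)

theorem satN_canonical_iff (φ : Form I) (x : CanonicalWorld I) :
    satN canonicalN canonicalV φ x ↔ φ ∈ x.1.1 := by
  induction φ generalizing x with
  | atom n => rfl
  | bot => exact iff_of_false id x.1.2.bot_notMem
  | neg φ ih => rw [satN, ih, x.1.2.neg_mem_iff]
  | or φ ψ ih₁ ih₂ => rw [satN, ih₁, ih₂, x.1.2.or_mem_iff]
  | box G hG φ ih =>
    simp only [satN, ih]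
    exact ⟨fun h => (hasBox_of_mem_ptwInter_canonicalN hG h).2,
      fun h => mem_ptwInter_canonicalN_of_hasBox ⟨hG, h⟩⟩

end Canonical

/-- The base logic plus all instances of (C_G) is sound and
strongly complete w.r.t. the class of models in which each N_i(w) is closed
under finite (binary) intersections. -/
theorem CG_finite_inter_sound_complete (I : Type) [DecidableEq I] :
    SoundComplete (BaseAx I ∪ CGAx I)
      (fun M : NbhModel I => ∀ (i : I) (w : M.W) (X Y : Set M.W),
        X ∈ M.N i w → Y ∈ M.N i w → X ∩ Y ∈ M.N i w) := by
  intro Γ φ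
  constructor
  · rintro ⟨l, hl, hp⟩ M hM w hw
    exact satN_imp.1 (hp.sound hM w) (satN_foldr_and.2 fun ψ hψ => hw ψ (hl ψ hψ))
  · intro h
    by_contra hn
    obtain ⟨Δ, hΔ, hΓ, hφ⟩ := exists_isMCS_of_not_deduces hn
    let x : CanonicalWorld I := (⟨Δ, hΔ⟩, fun p => ⟨_, p.1.2.choose_spec⟩)
    exact hφ ((satN_canonical_iff φ x).1 (h ⟨CanonicalWorld I, ⟨x⟩, canonicalN, canonicalV⟩
      (fun i w X Y => inter_mem_canonicalN) x
      fun ψ hψ => (satN_canonical_iff ψ x).2 (hΓ hψ)))
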